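/- Let 𝒢=(𝒱,ℰ) be a countable locally finite undirected graph without self-loops or multiple edges and X ⊆ 𝒜^𝒱 a topological Markov field possessing a safe symbol. Then X is an n.n.constraint space. -/

import Mathlib

open scoped Classical

namespace HC

variable {V : Type*} {A : Type*}

/-- The external vertex boundary of a set of vertices. -/
def boundary (G : SimpleGraph V) (F : Set V) : Set V :=
  {u | u ∉ F ∧ ∃ v ∈ F, G.Adj u v}

/-- The language of `X` on `F`: the set of patterns on `F` appearing in `X`. -/
def lang (X : Set (V → A)) (F : Set V) : Set (F → A) :=
  F.restrict '' X

/-- The `n`-ball around `v` in the graph metric. -/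
def ballSet (G : SimpleGraph V) (v : V) (n : ℕ) : Set V :=
  {u | ∃ p : G.Walk v u, p.length ≤ n}

/-- Asymptotic pairs: pairs of configurations in `X` differing at finitely many sites. -/
def Delta (X : Set (V → A)) : Set ((V → A) × (V → A)) :=
  {p | p.1 ∈ X ∧ p.2 ∈ X ∧ {v | p.1 v ≠ p.2 v}.Finite}

/-- Topological Markov field. -/
def IsTMF [TopologicalSpace A] (G : SimpleGraph V) (X : Set (V → A)) : Prop :=
  IsClosed X ∧
    ∀ x ∈ X, ∀ y ∈ X, ∀ F : Set V, F.Finite →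
      (∀ u ∈ boundary G F, x u = y u) →
      (fun v => if v ∈ F then x v else y v) ∈ X

/-- Nearest neighbour constraint space: the set of configurations avoiding a
set of forbidden patterns on finite cliques. -/
def IsNNConstraint (G : SimpleGraph V) (X : Set (V → A)) : Prop :=
  ∃ 𝓕 : ∀ F : Set V, Set (F → A),
    X = {x : V → A | ∀ F : Set V, F.Finite → G.IsClique F → F.restrict x ∉ 𝓕 F}

/-- `s` is a safe symbol for `X`. -/
def IsSafeSymbol (X : Set (V → A)) (s : A) : Prop :=
  ∀ x ∈ X, ∀ S : Set V, (fun v => if v ∈ S then x v else s) ∈ X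

/-- The pattern `(c at v, d at w)` belongs to the language of `X`. -/
def edgeB (X : Set (V → A)) (v w : V) (c d : A) : Prop :=
  ∃ x ∈ X, x v = c ∧ x w = d

/-- The single-site pattern `c at v` belongs to the language of `X`. -/
def siteB (X : Set (V → A)) (v : V) (c : A) : Prop :=
  ∃ x ∈ X, x v = c

/-- The pairs `(x,y)` and `(z,w)` are Markov-similar. -/
def MarkovSimilar (G : SimpleGraph V) (x y z w : V → A) : Prop :=
  ∃ S : Set V, S.Finite ∧
    (∀ u, u ∉ S → x u = y u ∧ z u = w u) ∧
    (∀ u, u ∈ S ∪ boundary G S → x u = z u ∧ y u = w u)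

/-- A Markov cocycle on `X` (realised as a real function on pairs of
configurations, vanishing off the asymptotic relation `Δ_X`). -/
def IsMarkovCocycle (G : SimpleGraph V) (X : Set (V → A))
    (M : (V → A) → (V → A) → ℝ) : Prop :=
  (∀ x y : V → A, (x, y) ∉ Delta X → M x y = 0) ∧
  (∀ x y z : V → A, (x, y) ∈ Delta X → (y, z) ∈ Delta X → M x z = M x y + M y z) ∧
  (∀ x y z w : V → A, (x, y) ∈ Delta X → (z, w) ∈ Delta X →
    MarkovSimilar G x y z w → M x y = M z w)

/-- A nearest neighbour interaction: a real weight for each pattern,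
vanishing on patterns whose domain is not a finite clique. -/
def IsNNInteraction (G : SimpleGraph V) (U : ∀ F : Set V, (F → A) → ℝ) : Prop :=
  ∀ F : Set V, ¬(F.Finite ∧ G.IsClique F) → ∀ p : F → A, U F p = 0

/-- `Σ_{F ⊆ V finite} (U(y|_F) - U(x|_F))`. -/
noncomputable def gibbsSum (U : ∀ F : Set V, (F → A) → ℝ) (x y : V → A) : ℝ :=
  ∑ᶠ F : Set V, (U F (F.restrict y) - U F (F.restrict x))

/-- A Gibbs cocycle with some nearest neighbour interaction. -/
def IsGibbsCocycle (G : SimpleGraph V) (X : Set (V → A))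
    (M : (V → A) → (V → A) → ℝ) : Prop :=
  (∀ x y : V → A, (x, y) ∉ Delta X → M x y = 0) ∧
  ∃ U : ∀ F : Set V, (F → A) → ℝ, IsNNInteraction G U ∧
    ∀ x y : V → A, (x, y) ∈ Delta X → M x y = gibbsSum U x y

/-- The space `𝐌_X` of Markov cocycles on `X`. -/
def markovSet (G : SimpleGraph V) (X : Set (V → A)) :
    Set ((V → A) → (V → A) → ℝ) :=
  {M | IsMarkovCocycle G X M}

/-- The space `𝐆_X` of Gibbs cocycles with nearest neighbour interactions on `X`. -/
def gibbsSet (G : SimpleGraph V) (X : Set (V → A)) :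
    Set ((V → A) → (V → A) → ℝ) :=
  {M | IsGibbsCocycle G X M}

/-- `X` is Hammersley-Clifford: `𝐌_X = 𝐆_X`. -/
def IsHammersleyClifford (G : SimpleGraph V) (X : Set (V → A)) : Prop :=
  markovSet G X = gibbsSet G X

/-- The action of a permutation of the vertices on configurations. -/
def confAct (g : Equiv.Perm V) (x : V → A) : V → A :=
  fun v => x (g⁻¹ v)

/-- `S` consists of automorphisms of the graph `G`. -/
def PreservesAdj (G : SimpleGraph V) (S : Subgroup (Equiv.Perm V)) : Prop :=
  ∀ g ∈ S, ∀ u v : V, G.Adj (g u) (g v) ↔ G.Adj u v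

/-- `X` is invariant under the subgroup `S`. -/
def InvariantSpace (S : Subgroup (Equiv.Perm V)) (X : Set (V → A)) : Prop :=
  ∀ g ∈ S, confAct g '' X = X

/-- The cocycle `M` is `S`-invariant. -/
def InvariantCocycle (S : Subgroup (Equiv.Perm V)) (M : (V → A) → (V → A) → ℝ) : Prop :=
  ∀ g ∈ S, ∀ x y : V → A, M (confAct g x) (confAct g y) = M x y

/-- The interaction `U` is `S`-invariant: `U(ga) = U(a)` for every pattern `a`. -/
def InvariantInteraction (S : Subgroup (Equiv.Perm V))
    (U : ∀ F : Set V, (F → A) → ℝ) : Prop :=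
  ∀ g ∈ S, ∀ F : Set V, ∀ x : V → A,
    U (⇑g '' F) ((⇑g '' F).restrict (confAct g x)) = U F (F.restrict x)

/-- The space `𝐌^G_X` of `S`-invariant Markov cocycles on `X`. -/
def markovSetInv (G : SimpleGraph V) (S : Subgroup (Equiv.Perm V)) (X : Set (V → A)) :
    Set ((V → A) → (V → A) → ℝ) :=
  {M | IsMarkovCocycle G X M ∧ InvariantCocycle S M}

/-- The space `𝐆^G_X` of Gibbs cocycles with `S`-invariant nearest neighbour
interactions on `X`. -/
def gibbsSetInv (G : SimpleGraph V) (S : Subgroup (Equiv.Perm V)) (X : Set (V → A)) :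
    Set ((V → A) → (V → A) → ℝ) :=
  {M | (∀ x y : V → A, (x, y) ∉ Delta X → M x y = 0) ∧
    ∃ U : ∀ F : Set V, (F → A) → ℝ, IsNNInteraction G U ∧ InvariantInteraction S U ∧
      ∀ x y : V → A, (x, y) ∈ Delta X → M x y = gibbsSum U x y}

/-- `X` is `G`-Hammersley-Clifford: `𝐌^G_X = 𝐆^G_X`. -/
def IsGHammersleyClifford (G : SimpleGraph V) (S : Subgroup (Equiv.Perm V))
    (X : Set (V → A)) : Prop :=
  markovSetInv G S X = gibbsSetInv G S X

/-- The symbol `a` can be folded into the symbol `b` in `X`. -/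
def FoldsInto (G : SimpleGraph V) (X : Set (V → A)) (a b : A) : Prop :=
  a ≠ b ∧
    ∀ v₁ v₂ v₃ : V, G.Adj v₁ v₂ → G.Adj v₂ v₃ → ∀ c : A,
      edgeB X v₁ v₂ a c →
        edgeB X v₁ v₂ b c ∧ edgeB X v₂ v₃ c b ∧
          ∃ x ∈ X, ∀ u ∈ boundary G (ballSet G v₁ 1), x u = b

/-- `X ∩ (𝒜∖{a})^𝒱`. -/
def foldSpace (X : Set (V → A)) (a : A) : Set (V → A) :=
  X ∩ {x | ∀ v, x v ≠ a}

/-- `Y` is a fold of `X` (and `X` an unfold of `Y`). -/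
def IsFoldOf (G : SimpleGraph V) (Y X : Set (V → A)) : Prop :=
  ∃ a b : A, FoldsInto G X a b ∧ Y = foldSpace X a

/-- `P₁, P₂` are the partite classes of a bipartition of `G`. -/
def IsBipartition (G : SimpleGraph V) (P₁ P₂ : Set V) : Prop :=
  (∀ v : V, v ∈ P₁ ∨ v ∈ P₂) ∧ Disjoint P₁ P₂ ∧
    ∀ u v : V, G.Adj u v → (u ∈ P₁ ∧ v ∈ P₂) ∨ (u ∈ P₂ ∧ v ∈ P₁)

/-- `G` is bipartite. -/
def Bipartite (G : SimpleGraph V) : Prop :=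
  ∃ P₁ P₂ : Set V, IsBipartition G P₁ P₂

/-- `θ^v_c(x)`: change the value of `x` at `v` to `c`. -/
noncomputable def theta (x : V → A) (v : V) (c : A) : V → A :=
  fun u => if u = v then c else x u

/-- `θ^{w₁,…,w_r}_{c₁,…,c_r}(x)`: change the value of `x` at each `w i` to `c i`. -/
noncomputable def multiUpdate (x : V → A) {r : ℕ} (w : Fin r → V) (c : Fin r → A) :
    V → A :=
  fun u => if h : ∃ i, w i = u then c h.choose else x u

/-- Restriction of a cocycle to the asymptotic pairs of a subspace `Y`. -/
noncomputable def restrictCocycle (Y : Set (V → A)) (M : (V → A) → (V → A) → ℝ) :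
    (V → A) → (V → A) → ℝ :=
  fun x y => if (x, y) ∈ Delta Y then M x y else 0

/-- The pair `(x,y)` is `U`-good for the cocycle `M`. -/
def VGood (M : (V → A) → (V → A) → ℝ) (U : ∀ F : Set V, (F → A) → ℝ)
    (x y : V → A) : Prop :=
  M x y = gibbsSum U x y

/-- `𝒱₁`: vertices `v` admitting a neighbour `w` with `(a,a) ∈ ℬ_{v,w}(X)`. -/
def Vone (G : SimpleGraph V) (X : Set (V → A)) (a : A) : Set V :=
  {v | ∃ w, G.Adj v w ∧ edgeB X v w a a}

/-- `𝒱₂`: vertices not in `𝒱₁` where the symbol `a` can appear. -/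
def Vtwo (G : SimpleGraph V) (X : Set (V → A)) (a : A) : Set V :=
  {v | v ∉ Vone G X a ∧ siteB X v a}

/-- The space of graph homomorphisms from `G` to `H`, as a configuration space. -/
def homSpace {B : Type*} (G : SimpleGraph V) (H : SimpleGraph B) : Set (V → B) :=
  {x | ∀ v w : V, G.Adj v w → H.Adj (x v) (x w)}

/-- A topological Markov field with a safe symbol is an
n.n.constraint space. -/
theorem statement2 [Countable V] [Fintype A] [TopologicalSpace A] [DiscreteTopology A]
    (G : SimpleGraph V) (hlf : ∀ v : V, (G.neighborSet v).Finite)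
    (X : Set (V → A)) (hX : IsTMF G X) (s : A) (hs : IsSafeSymbol X s) :
    IsNNConstraint G X := by
  obtain ⟨hcl, hM⟩ := hX
  refine ⟨fun F => (lang X F)ᶜ, ?_⟩
  ext x
  simp only [Set.mem_setOf_eq, Set.mem_compl_iff, not_not]
  constructor
  · intro hx F _ _
    exact ⟨x, hx, rfl⟩
  · intro h
    have key : ∀ n : ℕ, ∀ W : Finset V, W.card = n →
        (fun v => if v ∈ W then x v else s) ∈ X := by
      intro n
      induction n with
      | zero =>
        intro W hW
        obtain ⟨y, hy, -⟩ := h ∅ Set.finite_empty (by simp)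
        have := hs y hy ∅
        rw [Finset.card_eq_zero] at hW
        subst hW
        simpa using this
      | succ n ih =>
        intro W hW
        by_cases hc : G.IsClique (W : Set V)
        · obtain ⟨y, hy, hyx⟩ := h W W.finite_toSet hc
          have h1 := hs y hy (W : Set V)
          convert h1 using 2 with v
          by_cases hv : v ∈ W
          · have : y v = x v := congrFun hyx ⟨v, hv⟩
            simp [hv, this]
          · simp [hv]
        · obtain ⟨u, hu, v, hv, huv, hadj⟩ : ∃ u ∈ W, ∃ v ∈ W, u ≠ v ∧ ¬ G.Adj u v := by
            by_contra hcon
            push Not at hcon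
            exact hc fun a ha b hb hab => hcon a ha b hb hab
          have ha := ih (W.erase u) (by rw [Finset.card_erase_of_mem hu]; omega)
          have hb := ih (W.erase v) (by rw [Finset.card_erase_of_mem hv]; omega)
          have := hM _ hb _ ha {u} (Set.finite_singleton u) (by
            rintro t ⟨htu, w, hw, htw⟩
            simp only [Set.mem_singleton_iff] at htu hw
            subst hw
            have htv : t ≠ v := by
              rintro rfl
              exact hadj htw.symm
            simp [Finset.mem_erase, htu, htv])
          convert this using 2 with t
          by_cases ht : t = u
          · subst ht
            simp [hu, huv]
          · simp [ht]
    refine hcl.mem_of_tendsto (f := fun W : Finset V => fun v => if v ∈ W then x v else s)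
      (b := Filter.atTop) ?_ (Filter.Eventually.of_forall fun W => key _ W rfl)
    rw [tendsto_pi_nhds]
    intro v
    refine tendsto_const_nhds.congr' ?_
    filter_upwards [Filter.eventually_ge_atTop ({v} : Finset V)] with W hW
    have : v ∈ W := hW (Finset.mem_singleton_self v)
    simp [this]
end HC
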